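/- arXiv:2406.08417 — 2 statements merged into one kernel-verified Lean document; each statement's English description precedes it below -/
import Mathlib

section
/- Let θ : ℝ → ℝ be continuous and 2π-periodic, let L ∈ ℝ, and let z : ℝ → ℂ satisfy z(α) = z(0) + (L/(2π)) ∫_0^{α} e^{i(η+θ(η))} dη for all α. Assume the closedness condition ∫_{−π}^{π} e^{i(α+θ(α))} dα = 0. Then (1/2) Im ∫_{−π}^{π} conj(z(α)) · z′(α) dα = π (L/(2π))² (1 + (1/(2π)) Im ∫_{−π}^{π} ∫_0^{α} e^{i(α−η)} (e^{i(θ(α)−θ(η))} − 1) dη dα). -/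
open Complex in
/-- The inner convolution-type integral of the unit exponential. -/
theorem integral_exp_I_mul_sub (a : ℝ) :
    ∫ η in (0 : ℝ)..a, exp (I * ((a : ℂ) - (η : ℂ))) = I - I * exp (I * (a : ℂ)) := by
  have key : ∀ x ∈ Set.uIcc 0 a, HasDerivAt
      (fun η : ℝ => I * exp (I * ((a : ℂ) - (η : ℂ)))) (exp (I * ((a : ℂ) - (x : ℂ)))) x := by
    intro x _
    have h1 : HasDerivAt (fun η : ℝ => I * ((a : ℂ) - (η : ℂ))) (I * (-1)) x :=
      ((hasDerivAt_id x).ofReal_comp.const_sub (a : ℂ)).const_mul I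
    have h2 : I * (exp (I * ((a : ℂ) - (x : ℂ))) * (I * (-1))) = exp (I * ((a : ℂ) - (x : ℂ))) := by
      linear_combination (-exp (I * ((a : ℂ) - (x : ℂ)))) * I_mul_I
    exact h2 ▸ h1.cexp.const_mul I
  rw [intervalIntegral.integral_eq_sub_of_hasDerivAt key
    (Continuous.intervalIntegrable (by fun_prop) _ _)]
  simp

open Complex in
/-- The unit exponential has mean zero over a full period. -/
theorem integral_exp_I_mul_neg_pi_pi :
    ∫ a in (-Real.pi)..Real.pi, exp (I * (a : ℂ)) = 0 := by
  rw [integral_exp_mul_complex I_ne_zero, ofReal_neg, mul_neg, exp_neg, mul_comm I, exp_pi_mul_I]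
  norm_num


theorem stmt14 (θ : ℝ → ℝ) (hcont : Continuous θ)
    (hper : Function.Periodic θ (2 * Real.pi)) (L : ℝ) (z : ℝ → ℂ)
    (hz : ∀ α : ℝ, z α = z 0 +
      ((L / (2 * Real.pi) : ℝ) : ℂ) *
        ∫ η in (0 : ℝ)..α, Complex.exp (Complex.I * ((η : ℂ) + (θ η : ℂ))))
    (hclosed : (∫ α in (-Real.pi)..Real.pi,
      Complex.exp (Complex.I * ((α : ℂ) + (θ α : ℂ)))) = 0) :
    (1 / 2) * (∫ α in (-Real.pi)..Real.pi,
        (starRingEnd ℂ) (z α) *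
          (((L / (2 * Real.pi) : ℝ) : ℂ) *
            Complex.exp (Complex.I * ((α : ℂ) + (θ α : ℂ))))).im =
      Real.pi * (L / (2 * Real.pi)) ^ 2 *
        (1 + (1 / (2 * Real.pi)) *
          (∫ α in (-Real.pi)..Real.pi, ∫ η in (0 : ℝ)..α,
            Complex.exp (Complex.I * ((α : ℂ) - (η : ℂ))) *
              (Complex.exp (Complex.I * ((θ α : ℂ) - (θ η : ℂ))) - 1)).im) := by
  have hf : Continuous fun x : ℝ => Complex.exp (Complex.I * ((x : ℂ) + (θ x : ℂ))) := by
    fun_prop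
  generalize L / (2 * Real.pi) = c at *
  set f : ℝ → ℂ := fun x => Complex.exp (Complex.I * ((x : ℂ) + (θ x : ℂ))) with hfdef
  set F : ℝ → ℂ := fun a => ∫ η in (0 : ℝ)..a, f η with hF
  have hFc : Continuous F :=
    intervalIntegral.continuous_primitive (fun _ _ => hf.intervalIntegrable _ _) 0
  have hFs : Continuous fun a => (starRingEnd ℂ) (F a) := Complex.continuous_conj.comp hFc
  have hfs : Continuous fun a => (starRingEnd ℂ) (f a) := Complex.continuous_conj.comp hf
  have hE (a : ℝ) : Continuous fun η : ℝ => Complex.exp (Complex.I * ((a : ℂ) - (η : ℂ))) := by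
    fun_prop
  have hI : Continuous fun a : ℝ =>
      Complex.I - Complex.I * Complex.exp (Complex.I * (a : ℂ)) := by
    fun_prop
  have hconjF (a : ℝ) : ∫ η in (0 : ℝ)..a, (starRingEnd ℂ) (f η) = (starRingEnd ℂ) (F a) :=
    intervalIntegral.intervalIntegral_conj
  have hlhs : (∫ a in (-Real.pi)..Real.pi, (starRingEnd ℂ) (z a) * ((c : ℂ) * f a)) =
      ((c ^ 2 : ℝ) : ℂ) * ∫ a in (-Real.pi)..Real.pi, (starRingEnd ℂ) (F a) * f a := by
    have hexpand (a : ℝ) : (starRingEnd ℂ) (z a) * ((c : ℂ) * f a) =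
        ((starRingEnd ℂ) (z 0) * c) * f a +
          ((c ^ 2 : ℝ) : ℂ) * ((starRingEnd ℂ) (F a) * f a) := by
      rw [hz a, map_add, map_mul, Complex.conj_ofReal]
      push_cast
      ring
    simp_rw [hexpand]
    rw [intervalIntegral.integral_add ((hf.const_mul _).intervalIntegrable _ _)
      (((hFs.fun_mul hf).const_mul _).intervalIntegrable _ _),
      intervalIntegral.integral_const_mul, intervalIntegral.integral_const_mul, hclosed]
    simp
  have hinner (a : ℝ) : (∫ η in (0 : ℝ)..a,
      Complex.exp (Complex.I * ((a : ℂ) - (η : ℂ))) *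
        (Complex.exp (Complex.I * ((θ a : ℂ) - (θ η : ℂ))) - 1)) =
      (starRingEnd ℂ) (F a) * f a -
        (Complex.I - Complex.I * Complex.exp (Complex.I * (a : ℂ))) := by
    have hexpand (η : ℝ) : Complex.exp (Complex.I * ((a : ℂ) - (η : ℂ))) *
        (Complex.exp (Complex.I * ((θ a : ℂ) - (θ η : ℂ))) - 1) =
        (starRingEnd ℂ) (f η) * f a - Complex.exp (Complex.I * ((a : ℂ) - (η : ℂ))) := by
      simp only [hfdef, ← Complex.exp_conj, map_mul, map_add, Complex.conj_I,
        Complex.conj_ofReal]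
      rw [mul_sub, ← Complex.exp_add, ← Complex.exp_add, mul_one]
      ring_nf
    simp_rw [hexpand]
    rw [intervalIntegral.integral_sub
      ((hfs.mul_const (f a)).intervalIntegrable _ _)
      ((hE a).intervalIntegrable _ _),
      intervalIntegral.integral_mul_const, hconjF, integral_exp_I_mul_sub]
  have hrhs : (∫ a in (-Real.pi)..Real.pi, ((starRingEnd ℂ) (F a) * f a -
        (Complex.I - Complex.I * Complex.exp (Complex.I * (a : ℂ))))) =
      (∫ a in (-Real.pi)..Real.pi, (starRingEnd ℂ) (F a) * f a) -
        ((2 * Real.pi : ℝ) : ℂ) * Complex.I := by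
    rw [intervalIntegral.integral_sub ((hFs.fun_mul hf).intervalIntegrable _ _)
      (hI.intervalIntegrable _ _),
      intervalIntegral.integral_sub (Continuous.intervalIntegrable (by fun_prop) _ _)
      (Continuous.intervalIntegrable (by fun_prop) _ _),
      intervalIntegral.integral_const_mul, integral_exp_I_mul_neg_pi_pi,
      intervalIntegral.integral_const, Complex.real_smul]
    push_cast
    ring
  simp_rw [hinner]
  rw [hlhs, hrhs, Complex.im_ofReal_mul, Complex.sub_im, Complex.im_ofReal_mul, Complex.I_im]
  have := Real.pi_ne_zero
  field_simp
  ring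
end

section
/- For every integer k > 1, (ik − i/k) · lim_{ε→0⁺} lim_{r→1⁻} ∫_{ε ≤ |β| ≤ π} (−i e^{−iβ} (1 + e^{iβ} + e^{2iβ} + e^{3iβ}) e^{−ikβ}) / (4(−1 + r e^{iβ})) dβ = −π(k − 1/k). Equivalently, lim_{ε→0⁺} lim_{r→1⁻} ∫_{ε ≤ |β| ≤ π} e^{−i(k+1)β}(1 + e^{iβ} + e^{2iβ} + e^{3iβ})/(−1 + r e^{iβ}) dβ = −4π. -/
open Filter

/-- The regularized integrand
`(−i e^{−iβ}(1+e^{iβ}+e^{2iβ}+e^{3iβ}) e^{−ikβ})/(4(−1+re^{iβ}))`. -/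
noncomputable def J2integrand (k : ℤ) (r : ℝ) (β : ℝ) : ℂ :=
  (-Complex.I * Complex.exp (-Complex.I * β) *
      (1 + Complex.exp (Complex.I * β) + Complex.exp (2 * Complex.I * β) +
        Complex.exp (3 * Complex.I * β)) *
      Complex.exp (-Complex.I * k * β)) /
    (4 * (-1 + (r : ℂ) * Complex.exp (Complex.I * β)))

/-- On the unit circle, `1 - r z` stays comparable to `1 - z` for `r ≤ 1`. -/
lemma norm_neg_one_add_le_two_mul {z : ℂ} (hz : ‖z‖ = 1) {r : ℝ} (h0 : 0 ≤ r) (h1 : r ≤ 1) :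
    ‖-1 + z‖ ≤ 2 * ‖-1 + (r : ℂ) * z‖ := by
  have h2 : ‖-1 + z‖ ≤ ‖-1 + (r : ℂ) * z‖ + (1 - r) := by
    have : -1 + z = (-1 + (r : ℂ) * z) + ((1 - r : ℝ) : ℂ) * z := by push_cast; ring
    calc ‖-1 + z‖ = ‖(-1 + (r : ℂ) * z) + ((1 - r : ℝ) : ℂ) * z‖ := by rw [← this]
      _ ≤ _ := norm_add_le _ _
      _ = _ := by
        rw [norm_mul ((1 - r : ℝ) : ℂ), hz, Complex.norm_real, Real.norm_of_nonneg (by linarith),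
          mul_one]
  have h3 : 1 - r ≤ ‖-1 + (r : ℂ) * z‖ := by
    have := norm_sub_norm_le (-1 : ℂ) (-((r : ℂ) * z))
    rw [sub_neg_eq_add, norm_neg, norm_neg, norm_mul, hz, Complex.norm_real,
      Real.norm_of_nonneg h0, norm_one, mul_one] at this
    exact this
  linarith

lemma norm_exp_mul_I_mul (c : ℝ) (β : ℝ) : ‖Complex.exp ((c : ℂ) * Complex.I * β)‖ = 1 := by
  have : (c : ℂ) * Complex.I * β = ((c * β : ℝ) : ℂ) * Complex.I := by push_cast; ring
  rw [this, Complex.norm_exp_ofReal_mul_I]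

lemma norm_exp_I_mul (β : ℝ) : ‖Complex.exp (Complex.I * β)‖ = 1 := by
  simpa only [Complex.ofReal_one, one_mul] using norm_exp_mul_I_mul 1 β

lemma norm_J2integrand_le (k : ℤ) {r : ℝ} (h0 : 0 ≤ r) (h1 : r ≤ 1) {β : ℝ}
    (hβ : Complex.exp (Complex.I * β) ≠ 1) :
    ‖J2integrand k r β‖ ≤ 2 / ‖-1 + Complex.exp (Complex.I * β)‖ := by
  have hpos : 0 < ‖-1 + Complex.exp (Complex.I * β)‖ := by
    rw [norm_pos_iff]
    intro h
    exact hβ (by linear_combination h)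
  have hle := norm_neg_one_add_le_two_mul (norm_exp_I_mul β) h0 h1
  have e1 : ‖Complex.exp (-Complex.I * β)‖ = 1 := by simpa using norm_exp_mul_I_mul (-1) β
  have e2 : ‖Complex.exp (2 * Complex.I * β)‖ = 1 := by simpa using norm_exp_mul_I_mul 2 β
  have e3 : ‖Complex.exp (3 * Complex.I * β)‖ = 1 := by simpa using norm_exp_mul_I_mul 3 β
  have e4 : ‖Complex.exp (-Complex.I * k * β)‖ = 1 := by
    have := norm_exp_mul_I_mul (-k) β
    rw [← this]
    congr 2
    push_cast
    ring
  have hsum : ‖1 + Complex.exp (Complex.I * β) + Complex.exp (2 * Complex.I * β) +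
      Complex.exp (3 * Complex.I * β)‖ ≤ 4 := by
    refine (norm_add₄_le ..).trans ?_
    rw [norm_exp_I_mul, e2, e3, norm_one]
    norm_num
  unfold J2integrand
  rw [norm_div, norm_mul, norm_mul, norm_mul, norm_mul, e1, e4, norm_neg, Complex.norm_I,
    Complex.norm_ofNat, one_mul, one_mul, mul_one, div_le_div_iff₀ (by linarith) hpos]
  nlinarith

lemma continuousOn_J2integrand (k : ℤ) {r : ℝ} {s : Set ℝ}
    (h : ∀ β ∈ s, -1 + (r : ℂ) * Complex.exp (Complex.I * β) ≠ 0) :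
    ContinuousOn (J2integrand k r) s := by
  unfold J2integrand
  refine ContinuousOn.div (by fun_prop) (by fun_prop) fun β hβ => ?_
  exact mul_ne_zero (by norm_num) (h β hβ)

lemma neg_one_add_mul_ne_zero {z : ℂ} (hz : ‖z‖ = 1) (hz1 : z ≠ 1) {r : ℝ} (h0 : 0 ≤ r)
    (h1 : r ≤ 1) : -1 + (r : ℂ) * z ≠ 0 := by
  intro h
  have := norm_neg_one_add_le_two_mul hz h0 h1
  rw [h, norm_zero, mul_zero, norm_le_zero_iff] at this
  exact hz1 (by linear_combination this)

lemma intervalIntegrable_J2integrand_one (k : ℤ) {a b : ℝ}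
    (h : ∀ β ∈ Set.uIcc a b, Complex.exp (Complex.I * β) ≠ 1) :
    IntervalIntegrable (J2integrand k 1) MeasureTheory.volume a b :=
  (continuousOn_J2integrand k fun β hβ => neg_one_add_mul_ne_zero (norm_exp_I_mul β) (h β hβ)
    zero_le_one le_rfl).intervalIntegrable

lemma tendsto_integral_J2integrand (k : ℤ) {a b : ℝ}
    (h : ∀ β ∈ Set.uIcc a b, Complex.exp (Complex.I * β) ≠ 1) :
    Tendsto (fun r : ℝ => ∫ β in a..b, J2integrand k r β)
      (nhdsWithin 1 (Set.Iio 1)) (nhds (∫ β in a..b, J2integrand k 1 β)) := by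
  have hr : ∀ᶠ r : ℝ in nhdsWithin 1 (Set.Iio 1), 0 ≤ r ∧ r ≤ 1 := by
    filter_upwards [Ioo_mem_nhdsLT (zero_lt_one' ℝ)] with r hr
    exact ⟨hr.1.le, hr.2.le⟩
  refine intervalIntegral.tendsto_integral_filter_of_dominated_convergence
    (fun β : ℝ => 2 / ‖-1 + Complex.exp (Complex.I * β)‖) ?_ ?_ ?_ ?_
  · filter_upwards [hr] with r hr
    refine ContinuousOn.aestronglyMeasurable ?_ measurableSet_uIoc
    exact continuousOn_J2integrand k fun β hβ => neg_one_add_mul_ne_zero (norm_exp_I_mul β)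
      (h β (Set.uIoc_subset_uIcc hβ)) hr.1 hr.2
  · filter_upwards [hr] with r hr
    refine Eventually.of_forall fun β hβ => ?_
    exact norm_J2integrand_le k hr.1 hr.2 (h β (Set.uIoc_subset_uIcc hβ))
  · refine ContinuousOn.intervalIntegrable ?_
    refine ContinuousOn.div (by fun_prop) (by fun_prop) fun β hβ => ?_
    rw [norm_ne_zero_iff]
    intro h'
    exact h β hβ (by linear_combination h')
  · refine Eventually.of_forall fun β hβ => ?_
    have hne := neg_one_add_mul_ne_zero (norm_exp_I_mul β)
      (h β (Set.uIoc_subset_uIcc hβ)) zero_le_one le_rfl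
    have : ContinuousAt (fun r : ℝ => J2integrand k r β) 1 := by
      unfold J2integrand
      exact ContinuousAt.div (by fun_prop) (by fun_prop) (mul_ne_zero (by norm_num) hne)
    exact this.tendsto.mono_left nhdsWithin_le_nhds

/-- The Dirichlet kernel `1 + 2 cos β + ⋯ + 2 cos (m β)`. -/
noncomputable def dirichletKernel (m : ℕ) (β : ℝ) : ℝ :=
  1 + ∑ j ∈ Finset.range m, 2 * Real.cos ((j + 1) * β)

/-- A primitive of the Dirichlet kernel. -/
noncomputable def dirichletPrimitive (m : ℕ) (β : ℝ) : ℝ :=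
  β + ∑ j ∈ Finset.range m, 2 * (Real.sin ((j + 1) * β) / (j + 1))

lemma continuous_dirichletKernel (m : ℕ) : Continuous (dirichletKernel m) := by
  unfold dirichletKernel
  fun_prop

lemma continuous_dirichletPrimitive (m : ℕ) : Continuous (dirichletPrimitive m) := by
  unfold dirichletPrimitive
  fun_prop

lemma hasDerivAt_dirichletPrimitive (m : ℕ) (β : ℝ) :
    HasDerivAt (dirichletPrimitive m) (dirichletKernel m β) β := by
  unfold dirichletPrimitive dirichletKernel
  refine (hasDerivAt_id' β).add (HasDerivAt.fun_sum fun j _ => ?_)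
  have hj : (j : ℝ) + 1 ≠ 0 := by positivity
  have := (((hasDerivAt_id' β).const_mul ((j : ℝ) + 1)).sin.div_const ((j : ℝ) + 1)).const_mul 2
  refine this.congr_deriv ?_
  field_simp

lemma dirichletPrimitive_zero (m : ℕ) : dirichletPrimitive m 0 = 0 := by
  simp [dirichletPrimitive]

lemma dirichletPrimitive_pi (m : ℕ) : dirichletPrimitive m Real.pi = Real.pi := by
  have (j : ℕ) : Real.sin (((j : ℝ) + 1) * Real.pi) = 0 := by
    exact_mod_cast Real.sin_nat_mul_pi (j + 1)
  simp [dirichletPrimitive, this]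

lemma integral_dirichletKernel (m : ℕ) (a : ℝ) :
    ∫ β in a..Real.pi, dirichletKernel m β = Real.pi - dirichletPrimitive m a := by
  rw [intervalIntegral.integral_eq_sub_of_hasDerivAt
    (fun β _ => hasDerivAt_dirichletPrimitive m β)
    ((continuous_dirichletKernel m).intervalIntegrable _ _), dirichletPrimitive_pi]

lemma exp_sub_one_mul_dirichletKernel (m : ℕ) (β : ℝ) :
    (Complex.exp (Complex.I * β) - 1) * (dirichletKernel m β : ℂ) =
      Complex.exp (Complex.I * β) ^ (m + 1) - Complex.exp (-(Complex.I * β)) ^ m := by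
  have hzw : Complex.exp (Complex.I * β) * Complex.exp (-(Complex.I * β)) = 1 := by
    rw [← Complex.exp_add, add_neg_cancel, Complex.exp_zero]
  induction m with
  | zero => simp [dirichletKernel]
  | succ m ih =>
    have hcos : (2 * Real.cos (((m : ℝ) + 1) * β) : ℂ) =
        Complex.exp (Complex.I * β) ^ (m + 1) + Complex.exp (-(Complex.I * β)) ^ (m + 1) := by
      rw [Complex.ofReal_cos, Complex.two_cos, ← Complex.exp_nat_mul, ← Complex.exp_nat_mul]
      congr 2 <;> push_cast <;> ring
    have hrec : (dirichletKernel (m + 1) β : ℂ) =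
        dirichletKernel m β + 2 * Real.cos (((m : ℝ) + 1) * β) := by
      unfold dirichletKernel
      rw [Finset.sum_range_succ]
      push_cast
      ring
    rw [hrec, hcos, mul_add, ih]
    linear_combination Complex.exp (-(Complex.I * β)) ^ m * hzw

lemma J2integrand_add_neg (n : ℕ) {β : ℝ} (hβ : Complex.exp (Complex.I * β) ≠ 1) :
    J2integrand (n + 2) 1 (-β) + J2integrand (n + 2) 1 β =
      Complex.I / 4 * (∑ j ∈ Finset.range 4, dirichletKernel (n + j) β : ℝ) := by
  have hzw : Complex.exp (Complex.I * β) * Complex.exp (-(Complex.I * β)) = 1 := by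
    rw [← Complex.exp_add, add_neg_cancel, Complex.exp_zero]
  have d0 := exp_sub_one_mul_dirichletKernel n β
  have d1 := exp_sub_one_mul_dirichletKernel (n + 1) β
  have d2 := exp_sub_one_mul_dirichletKernel (n + 2) β
  have d3 := exp_sub_one_mul_dirichletKernel (n + 3) β
  have p1 : Complex.exp (-Complex.I * β) = Complex.exp (-(Complex.I * β)) := by ring_nf
  have p2 : Complex.exp (2 * Complex.I * β) = Complex.exp (Complex.I * β) ^ 2 := by
    rw [← Complex.exp_nat_mul]; push_cast; ring_nf
  have p3 : Complex.exp (3 * Complex.I * β) = Complex.exp (Complex.I * β) ^ 3 := by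
    rw [← Complex.exp_nat_mul]; push_cast; ring_nf
  have p4 : Complex.exp (-Complex.I * ((n : ℂ) + 2) * β) =
      Complex.exp (-(Complex.I * β)) ^ (n + 2) := by
    rw [← Complex.exp_nat_mul]; push_cast; ring_nf
  have q0 : Complex.exp (Complex.I * -β) = Complex.exp (-(Complex.I * β)) := by ring_nf
  have q1 : Complex.exp (-Complex.I * -β) = Complex.exp (Complex.I * β) := by ring_nf
  have q2 : Complex.exp (2 * Complex.I * -β) = Complex.exp (-(Complex.I * β)) ^ 2 := by
    rw [← Complex.exp_nat_mul]; push_cast; ring_nf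
  have q3 : Complex.exp (3 * Complex.I * -β) = Complex.exp (-(Complex.I * β)) ^ 3 := by
    rw [← Complex.exp_nat_mul]; push_cast; ring_nf
  have q4 : Complex.exp (-Complex.I * ((n : ℂ) + 2) * -β) =
      Complex.exp (Complex.I * β) ^ (n + 2) := by
    rw [← Complex.exp_nat_mul]; push_cast; ring_nf
  unfold J2integrand
  push_cast
  rw [p1, p2, p3, p4, q0, q1, q2, q3, q4]
  simp only [Finset.sum_range_succ, Finset.sum_range_zero, zero_add, add_zero, one_mul]
  generalize Complex.exp (Complex.I * β) = z at *
  generalize Complex.exp (-(Complex.I * β)) = w at *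
  have hz : z ≠ 0 := left_ne_zero_of_mul_eq_one hzw
  have hz1 : z - 1 ≠ 0 := sub_ne_zero.mpr hβ
  obtain rfl : w = z⁻¹ := eq_inv_of_mul_eq_one_right hzw
  rw [mul_comm, ← eq_div_iff hz1] at d0 d1 d2 d3
  rw [d0, d1, d2, d3]
  have e1 : -1 + z⁻¹ = -(z - 1) / z := by field_simp; ring
  have e2 : -1 + z = z - 1 := by ring
  rw [e1, e2]
  simp only [inv_pow, pow_succ, pow_zero]
  field_simp
  ring

lemma exp_I_mul_ne_one {β : ℝ} (h0 : 0 < |β|) (hπ : |β| ≤ Real.pi) :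
    Complex.exp (Complex.I * β) ≠ 1 := by
  intro h
  have hcos : Real.cos β = 1 := by
    rw [← Complex.exp_ofReal_mul_I_re, mul_comm, h, Complex.one_re]
  have hb := abs_le.mp hπ
  rw [Real.cos_eq_one_iff_of_lt_of_lt (by linarith [Real.pi_pos]) (by linarith [Real.pi_pos])]
    at hcos
  exact h0.ne' (by rw [hcos, abs_zero])

lemma integral_J2integrand_one (n : ℕ) {ε : ℝ} (h0 : 0 < ε) (hπ : ε < Real.pi) :
    (∫ β in (-Real.pi)..(-ε), J2integrand (n + 2) 1 β) +
        ∫ β in ε..Real.pi, J2integrand (n + 2) 1 β =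
      Complex.I / 4 *
        (∑ j ∈ Finset.range 4, (Real.pi - dirichletPrimitive (n + j) ε) : ℝ) := by
  have hpos : ∀ β ∈ Set.uIcc ε Real.pi, Complex.exp (Complex.I * β) ≠ 1 := by
    intro β hβ
    rw [Set.uIcc_of_le hπ.le] at hβ
    have : |β| = β := abs_of_pos (h0.trans_le hβ.1)
    exact exp_I_mul_ne_one (by linarith [hβ.1]) (by linarith [hβ.2])
  have hneg : ∀ β ∈ Set.uIcc (-ε) (-Real.pi), Complex.exp (Complex.I * β) ≠ 1 := by
    intro β hβ
    rw [Set.uIcc_of_ge (by linarith)] at hβ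
    have : |β| = -β := abs_of_neg (by linarith [hβ.2])
    exact exp_I_mul_ne_one (by linarith [hβ.2]) (by linarith [hβ.1])
  have hi : IntervalIntegrable (fun β => J2integrand (n + 2) 1 (-β)) MeasureTheory.volume
      ε Real.pi := by
    simpa using
      (IntervalIntegrable.iff_comp_neg).mp (intervalIntegrable_J2integrand_one (n + 2) hneg)
  rw [← intervalIntegral.integral_comp_neg, ← intervalIntegral.integral_add hi
    (intervalIntegrable_J2integrand_one _ hpos),
    intervalIntegral.integral_congr fun β hβ => J2integrand_add_neg n (hpos β hβ),
    intervalIntegral.integral_const_mul, intervalIntegral.integral_ofReal,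
    intervalIntegral.integral_finsetSum fun j _ =>
      (continuous_dirichletKernel (n + j)).intervalIntegrable _ _]
  simp only [integral_dirichletKernel]

theorem stmt15 (k : ℤ) (hk : 1 < k) :
    ∃ F : ℝ → ℂ,
      (∀ ε : ℝ, 0 < ε → ε < Real.pi →
        Tendsto (fun r : ℝ =>
            (∫ β in (-Real.pi)..(-ε), J2integrand k r β) +
              ∫ β in ε..Real.pi, J2integrand k r β)
          (nhdsWithin 1 (Set.Iio 1)) (nhds (F ε))) ∧
      Tendsto (fun ε : ℝ => (Complex.I * k - Complex.I / k) * F ε)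
        (nhdsWithin 0 (Set.Ioi 0))
        (nhds (-(Real.pi : ℂ) * ((k : ℂ) - 1 / (k : ℂ)))) := by
  obtain ⟨n, rfl⟩ : ∃ n : ℕ, k = n + 2 := ⟨(k - 2).toNat, by omega⟩
  refine ⟨fun ε => Complex.I / 4 *
    (∑ j ∈ Finset.range 4, (Real.pi - dirichletPrimitive (n + j) ε) : ℝ), ?_, ?_⟩
  · intro ε h0 hπ
    beta_reduce
    rw [← integral_J2integrand_one n h0 hπ]
    refine (tendsto_integral_J2integrand _ fun β hβ => ?_).add
      (tendsto_integral_J2integrand _ fun β hβ => ?_)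
    · rw [Set.uIcc_of_le (by linarith)] at hβ
      have : |β| = -β := abs_of_neg (by linarith [hβ.2])
      exact exp_I_mul_ne_one (by linarith [hβ.2]) (by linarith [hβ.1])
    · rw [Set.uIcc_of_le hπ.le] at hβ
      have : |β| = β := abs_of_pos (h0.trans_le hβ.1)
      exact exp_I_mul_ne_one (by linarith [hβ.1]) (by linarith [hβ.2])
  · have hc (m : ℕ) := continuous_dirichletPrimitive m
    refine (Continuous.tendsto' (by fun_prop) _ _ ?_).mono_left nhdsWithin_le_nhds
    simp only [dirichletPrimitive_zero, sub_zero, Finset.sum_const, Finset.card_range]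
    push_cast
    simp only [nsmul_eq_mul]
    push_cast
    linear_combination (Real.pi : ℂ) * ((n : ℂ) + 2 - 1 / ((n : ℂ) + 2)) * Complex.I_mul_I
end
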